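/- arXiv:1508.02928 — 6 statements merged into one kernel-verified Lean document; each statement's English description precedes it below -/
import Mathlib

section
/- There exists a function f : ℝ → ℝ that is continuous at every point of ℝ but is not differentiable at any point of ℝ. -/
/-- A lacunary cosine series of Weierstrass type. -/
noncomputable def weierstrassSeries (x : ℝ) : ℝ :=
  ∑' n : ℕ, (1 / 2 : ℝ) ^ n * Real.cos (64 ^ n * x)

theorem norm_weierstrassSeries_term_le (n : ℕ) (x : ℝ) :
    ‖(1 / 2 : ℝ) ^ n * Real.cos (64 ^ n * x)‖ ≤ (1 / 2 : ℝ) ^ n := by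
  rw [norm_mul, Real.norm_of_nonneg (by positivity : (0 : ℝ) ≤ (1 / 2) ^ n)]
  exact mul_le_of_le_one_right (by positivity) (Real.abs_cos_le_one _)

theorem continuous_weierstrassSeries : Continuous weierstrassSeries :=
  continuous_tsum (fun n => by fun_prop) summable_geometric_two norm_weierstrassSeries_term_le

theorem summable_weierstrassSeries (x : ℝ) :
    Summable fun n : ℕ => (1 / 2 : ℝ) ^ n * Real.cos (64 ^ n * x) :=
  .of_norm_bounded summable_geometric_two fun n => norm_weierstrassSeries_term_le n x

/-- A shift by a quarter or by half a period changes the cosine by at least `1 / 2`. -/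
theorem exists_half_le_abs_cos_add_sub_cos (t : ℝ) :
    ∃ j : ℕ, 1 ≤ j ∧ j ≤ 2 ∧ 1 / 2 ≤ |Real.cos (t + j * (Real.pi / 2)) - Real.cos t| := by
  by_cases h : 1 / 4 ≤ |Real.cos t|
  · refine ⟨2, by norm_num, le_rfl, ?_⟩
    have e : t + (2 : ℕ) * (Real.pi / 2) = t + Real.pi := by push_cast; ring
    rw [e, Real.cos_add_pi, show -Real.cos t - Real.cos t = -2 * Real.cos t by ring, abs_mul]
    norm_num
    linarith
  · refine ⟨1, le_rfl, by norm_num, ?_⟩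
    rw [Nat.cast_one, one_mul, Real.cos_add_pi_div_two]
    have hc := abs_lt.1 (not_le.1 h)
    have hs : 3 / 4 ≤ |Real.sin t| := by
      refine (sq_le_sq₀ (by norm_num) (abs_nonneg _)).1 ?_
      rw [sq_abs]
      nlinarith [Real.sin_sq_add_cos_sq t]
    rcases le_abs.1 hs with h1 | h1
    · exact le_abs.2 (Or.inr (by linarith))
    · exact le_abs.2 (Or.inl (by linarith))

theorem cos_pow_mul_add_shift {m n : ℕ} (hmn : m < n) (j : ℕ) (x : ℝ) :
    Real.cos (64 ^ n * (x + j * (Real.pi / 2) / 64 ^ m)) = Real.cos (64 ^ n * x) := by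
  obtain ⟨k, rfl⟩ := Nat.exists_eq_add_of_lt hmn
  have e : (64 : ℝ) ^ (m + k + 1) * (x + j * (Real.pi / 2) / 64 ^ m) =
      64 ^ (m + k + 1) * x + ((16 * 64 ^ k * j : ℕ) : ℝ) * (2 * Real.pi) := by
    push_cast
    field_simp
    ring
  rw [e, Real.cos_add_nat_mul_two_pi]

theorem exists_le_abs_weierstrassSeries_sub (x : ℝ) (m : ℕ) :
    ∃ h : ℝ, 0 < h ∧ h ≤ 4 / 64 ^ m ∧
      1 / 4 * (1 / 2) ^ m ≤ |weierstrassSeries (x + h) - weierstrassSeries x| := by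
  obtain ⟨j, hj1, hj2, hj⟩ := exists_half_le_abs_cos_add_sub_cos (64 ^ m * x)
  set h : ℝ := j * (Real.pi / 2) / 64 ^ m with hh
  have hj1' : (1 : ℝ) ≤ j := by exact_mod_cast hj1
  have hj2' : (j : ℝ) ≤ 2 := by exact_mod_cast hj2
  have hpi := Real.pi_pos
  have h0 : 0 < h := by positivity
  have hle : h ≤ 4 / 64 ^ m := by
    rw [hh]
    gcongr
    nlinarith [Real.pi_le_four]
  refine ⟨h, h0, hle, ?_⟩
  have hsub : weierstrassSeries (x + h) - weierstrassSeries x =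
      ∑ n ∈ Finset.range m, (1 / 2 : ℝ) ^ n *
        (Real.cos (64 ^ n * (x + h)) - Real.cos (64 ^ n * x)) +
      (1 / 2 : ℝ) ^ m * (Real.cos (64 ^ m * (x + h)) - Real.cos (64 ^ m * x)) := by
    rw [← Finset.sum_range_succ, weierstrassSeries, weierstrassSeries,
      ← (summable_weierstrassSeries _).tsum_sub (summable_weierstrassSeries x)]
    simp_rw [← mul_sub]
    refine tsum_eq_sum fun n hn => ?_
    rw [cos_pow_mul_add_shift (by simpa [Nat.lt_succ_iff] using hn), sub_self, mul_zero]
  have hmain : 1 / 2 * (1 / 2 : ℝ) ^ m ≤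
      |(1 / 2 : ℝ) ^ m * (Real.cos (64 ^ m * (x + h)) - Real.cos (64 ^ m * x))| := by
    have e : (64 : ℝ) ^ m * (x + h) = 64 ^ m * x + j * (Real.pi / 2) := by
      rw [hh]
      field_simp
    rw [e, abs_mul, abs_of_pos (by positivity : (0 : ℝ) < (1 / 2) ^ m), mul_comm]
    gcongr
  have hlow : |∑ n ∈ Finset.range m, (1 / 2 : ℝ) ^ n *
      (Real.cos (64 ^ n * (x + h)) - Real.cos (64 ^ n * x))| ≤ 1 / 4 * (1 / 2) ^ m := by
    calc _ ≤ ∑ n ∈ Finset.range m, (32 : ℝ) ^ n * h := by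
          refine (Finset.abs_sum_le_sum_abs _ _).trans (Finset.sum_le_sum fun n _ => ?_)
          rw [abs_mul, abs_of_pos (by positivity : (0 : ℝ) < (1 / 2) ^ n)]
          calc _ ≤ (1 / 2 : ℝ) ^ n * |64 ^ n * (x + h) - 64 ^ n * x| := by
                exact mul_le_mul_of_nonneg_left (Real.abs_cos_sub_cos_le _ _) (by positivity)
            _ = 32 ^ n * h := by
                rw [← mul_sub, add_sub_cancel_left, abs_of_pos (by positivity), ← mul_assoc,
                  ← mul_pow]
                norm_num
      _ = (32 ^ m - 1) / 31 * h := by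
          rw [← Finset.sum_mul, geom_sum_eq (by norm_num)]
          norm_num
      _ ≤ 32 ^ m / 31 * (4 / 64 ^ m) := by
          gcongr
          linarith
      _ = 4 / 31 * (1 / 2) ^ m := by
          rw [show (1 / 2 : ℝ) = 32 / 64 by norm_num, div_pow]
          ring
      _ ≤ 1 / 4 * (1 / 2) ^ m := by
          exact mul_le_mul_of_nonneg_right (by norm_num) (by positivity)
  rw [hsub, add_comm]
  have := abs_sub_abs_le_abs_add ((1 / 2 : ℝ) ^ m *
    (Real.cos (64 ^ m * (x + h)) - Real.cos (64 ^ m * x))) (∑ n ∈ Finset.range m, (1 / 2 : ℝ) ^ n *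
      (Real.cos (64 ^ n * (x + h)) - Real.cos (64 ^ n * x)))
  linarith

theorem not_differentiableAt_weierstrassSeries (x : ℝ) :
    ¬ DifferentiableAt ℝ weierstrassSeries x := by
  intro hd
  choose h h0 hle hge using exists_le_abs_weierstrassSeries_sub x
  have hlim : Filter.Tendsto h Filter.atTop (nhds 0) := by
    refine squeeze_zero (fun m => (h0 m).le) hle ?_
    exact (tendsto_pow_atTop_atTop_of_one_lt (by norm_num : (1 : ℝ) < 64)).const_div_atTop 4
  have hx : Filter.Tendsto (fun m => x + h m) Filter.atTop (nhds x) := by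
    simpa using hlim.const_add x
  obtain ⟨C, hC⟩ := (hd.isBigO_sub.comp_tendsto hx).bound
  obtain ⟨m, hm, hbig⟩ := (hC.and ((tendsto_pow_atTop_atTop_of_one_lt
    (by norm_num : (1 : ℝ) < 32)).eventually_gt_atTop (16 * |C|))).exists
  simp only [Function.comp_apply, add_sub_cancel_left, Real.norm_eq_abs, abs_of_pos (h0 m)] at hm
  have hupper : 1 / 4 * (1 / 2 : ℝ) ^ m ≤ |C| * (4 / 64 ^ m) :=
    ((hge m).trans hm).trans (mul_le_mul (le_abs_self C) (hle m) (h0 m).le (abs_nonneg C))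
  rw [show (1 / 2 : ℝ) = 32 / 64 by norm_num, div_pow, ← mul_div_assoc, ← mul_div_assoc,
    div_le_div_iff_of_pos_right (by positivity)] at hupper
  linarith

/-- There exists a function `f : ℝ → ℝ` that is continuous everywhere but
differentiable nowhere. -/
theorem exists_continuous_nowhere_differentiable :
    ∃ f : ℝ → ℝ, Continuous f ∧ ∀ x : ℝ, ¬ DifferentiableAt ℝ f x :=
  ⟨weierstrassSeries, continuous_weierstrassSeries, not_differentiableAt_weierstrassSeries⟩
end

section
/- Let f be meromorphic on all of ℂ. Then there exist entire functions g, h : ℂ → ℂ, with h not identically zero, such that f(z) = g(z) / h(z) for every z ∈ ℂ at which h(z) ≠ 0. -/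
open Filter Topology Metric Set

/-- A holomorphic function without zeros on a disc centred at the origin has a holomorphic
logarithm there. -/
lemma exists_differentiableOn_exp_eq {P : ℂ → ℂ} {R : ℝ} (hR : 0 < R)
    (hP : DifferentiableOn ℂ P (ball 0 R)) (h0 : ∀ z ∈ ball (0 : ℂ) R, P z ≠ 0) :
    ∃ L : ℂ → ℂ, DifferentiableOn ℂ L (ball 0 R) ∧
      ∀ z ∈ ball (0 : ℂ) R, Complex.exp (L z) = P z := by
  have hmem : (0 : ℂ) ∈ ball (0 : ℂ) R := mem_ball_self hR
  have hq : DifferentiableOn ℂ (fun z ↦ deriv P z / P z) (ball 0 R) :=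
    (hP.deriv isOpen_ball).div hP h0
  obtain ⟨L, hL0, hL⟩ := hq.isExactOn_ball.with_val_at 0 (Complex.log (P 0))
  have hLd : DifferentiableOn ℂ L (ball 0 R) := fun z hz ↦
    (hL z hz).differentiableAt.differentiableWithinAt
  refine ⟨L, hLd, fun z hz ↦ ?_⟩
  have hder : ∀ w ∈ ball (0 : ℂ) R,
      HasDerivAt (fun w ↦ P w * Complex.exp (-L w)) 0 w := fun w hw ↦ by
    have h1 := (hP.differentiableAt (isOpen_ball.mem_nhds hw)).hasDerivAt.mul (hL w hw).neg.cexp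
    refine h1.congr_deriv ?_
    have := h0 w hw
    field_simp
    simp
  have hconst := isOpen_ball.is_const_of_deriv_eq_zero (convex_ball (0 : ℂ) R).isPreconnected
    (fun w hw ↦ (hder w hw).differentiableAt.differentiableWithinAt)
    (fun w hw ↦ (hder w hw).deriv) hz hmem
  simp only [hL0, Complex.exp_neg, Complex.exp_log (h0 0 hmem), mul_inv_cancel₀ (h0 0 hmem)]
    at hconst
  exact (eq_of_div_eq_one (by rwa [div_eq_mul_inv])).symm

/-- An entire function without zeros on a disc becomes arbitrarily close to `1` on a smaller disc
after multiplication with the exponential of a suitable entire function. -/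
lemma exists_norm_mul_exp_sub_one_le {P : ℂ → ℂ} (hP : Differentiable ℂ P) {r R : ℝ} (hrR : r < R)
    (h0 : ∀ z ∈ ball (0 : ℂ) R, P z ≠ 0) {ε : ℝ} (hε : 0 < ε) :
    ∃ Q : ℂ → ℂ, Differentiable ℂ Q ∧ ∀ z : ℂ, ‖z‖ ≤ r → ‖P z * Complex.exp (Q z) - 1‖ ≤ ε := by
  rcases lt_or_ge r 0 with hr | hr
  · exact ⟨0, differentiable_const 0, fun z hz ↦ absurd (norm_nonneg z) (by linarith)⟩
  obtain ⟨L, hLd, hL⟩ := exists_differentiableOn_exp_eq (hr.trans_lt hrR) hP.differentiableOn h0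
  obtain ⟨s, hrs, hsR⟩ := exists_between hrR
  obtain ⟨t, hst, htR⟩ := exists_between hsR
  lift s to NNReal using (hr.trans hrs.le)
  lift t to NNReal using (s.2.trans hst.le)
  have hs : s < t := by exact_mod_cast hst
  have hps := (hLd.mono (closedBall_subset_ball htR)).hasFPowerSeriesOnBall (bot_le.trans_lt hs)
  have hcont : Tendsto Complex.exp (𝓝 0) (𝓝 1) := by
    simpa using Complex.continuous_exp.tendsto 0
  obtain ⟨δ, hδ, hexp⟩ := Metric.tendsto_nhds_nhds.1 hcont ε hε
  obtain ⟨n, hn⟩ := (Metric.tendstoUniformlyOn_iff.1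
    (hps.tendstoUniformlyOn' (r' := s) (by exact_mod_cast hs)) δ hδ).exists
  set p := cauchyPowerSeries L 0 t
  refine ⟨fun z ↦ -p.partialSum n z, ?_, fun z hz ↦ ?_⟩
  · refine Differentiable.neg ?_
    unfold FormalMultilinearSeries.partialSum
    simp only [FormalMultilinearSeries.apply_eq_pow_smul_coeff]
    fun_prop
  · have hzs : z ∈ ball (0 : ℂ) s := by simpa using hz.trans_lt hrs
    have h1 := hn z hzs
    rw [sub_zero, dist_eq_norm] at h1
    have h2 := hexp (x := L z - p.partialSum n z) (by simpa using h1)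
    rw [dist_eq_norm, sub_eq_add_neg (L z), Complex.exp_add,
      hL z (ball_subset_ball hsR.le hzs)] at h2
    exact h2.le

lemma summable_norm_of_norm_le_half_pow {u : ℕ → ℂ → ℂ}
    (hb : ∀ n : ℕ, ∀ z : ℂ, ‖z‖ ≤ n - 1 → ‖u n z‖ ≤ (1 / 2) ^ n) (z : ℂ) :
    Summable fun n ↦ ‖u n z‖ := by
  refine summable_geometric_two.of_norm_bounded_eventually_nat ?_
  filter_upwards [eventually_ge_atTop ⌈‖z‖ + 1⌉₊] with n hn
  simpa using hb n z (by linarith [Nat.ceil_le.1 hn])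

lemma differentiable_tprod_one_add {u : ℕ → ℂ → ℂ} (hd : ∀ n, Differentiable ℂ (u n))
    (hb : ∀ n : ℕ, ∀ z : ℂ, ‖z‖ ≤ n - 1 → ‖u n z‖ ≤ (1 / 2) ^ n) :
    Differentiable ℂ fun z ↦ ∏' n, (1 + u n z) := by
  intro z
  have hball : ball (0 : ℂ) (‖z‖ + 1) ∈ 𝓝 z := isOpen_ball.mem_nhds (by simp)
  have h := Summable.hasProdLocallyUniformlyOn_nat_one_add (f := u)
    (isOpen_ball (x := (0 : ℂ)) (ε := ‖z‖ + 1)) summable_geometric_two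
    (by
      filter_upwards [eventually_ge_atTop ⌈‖z‖ + 2⌉₊] with n hn w hw
      have := Nat.ceil_le.1 hn
      have hw' : ‖w‖ < ‖z‖ + 1 := by simpa using hw
      exact hb n w (by linarith))
    (fun n ↦ (hd n).continuous.continuousOn)
  rw [hasProdLocallyUniformlyOn_iff_tendstoLocallyUniformlyOn] at h
  refine (h.differentiableOn (Eventually.of_forall fun s ↦ ?_) isOpen_ball).differentiableAt hball
  have := fun n ↦ (hd n)
  fun_prop

/-- Weierstrass: there is an entire function vanishing to at least prescribed orders on a locally
finite set, and without zeros off this set. -/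
lemma exists_differentiable_forall_eq_pow_mul {S : Set ℂ}
    (hS : ∀ R : ℝ, (closedBall 0 R ∩ S).Finite) (N : ℂ → ℕ) :
    ∃ h : ℂ → ℂ, Differentiable ℂ h ∧ (∀ z ∉ S, h z ≠ 0) ∧
      ∀ a ∈ S, ∃ k : ℂ → ℂ, Differentiable ℂ k ∧ ∀ z, h z = (z - a) ^ N a * k z := by
  classical
  have hfin (n : ℕ) : {a ∈ S | ⌊‖a‖⌋₊ = n}.Finite :=
    (hS (n + 1)).subset fun a ⟨haS, han⟩ ↦
      ⟨by simpa [← han] using (Nat.lt_floor_add_one ‖a‖).le, haS⟩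
  let P (n : ℕ) (z : ℂ) : ℂ := ∏ a ∈ (hfin n).toFinset, (z - a) ^ N a
  have hPd (n : ℕ) : Differentiable ℂ (P n) := by fun_prop
  have hP0 (n : ℕ) (z : ℂ) (hz : ∀ a ∈ S, ⌊‖a‖⌋₊ = n → z ≠ a) : P n z ≠ 0 :=
    Finset.prod_ne_zero_iff.2 fun a ha ↦ by
      obtain ⟨haS, han⟩ := (hfin n).mem_toFinset.1 ha
      exact pow_ne_zero _ (sub_ne_zero.2 (hz a haS han))
  have hQ (n : ℕ) : ∃ Q : ℂ → ℂ, Differentiable ℂ Q ∧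
      ∀ z : ℂ, ‖z‖ ≤ n - 1 → ‖P n z * Complex.exp (Q z) - 1‖ ≤ (1 / 2) ^ n := by
    refine exists_norm_mul_exp_sub_one_le (hPd n) (sub_one_lt (n : ℝ)) (fun z hz ↦ ?_)
      (by positivity)
    refine hP0 n z ?_
    rintro a - han rfl
    have h1 : ‖z‖ < n := by simpa using hz
    exact absurd (Nat.floor_le (norm_nonneg z)) (by rw [han]; exact not_le.2 h1)
  choose Q hQd hQb using hQ
  let u (n : ℕ) (z : ℂ) : ℂ := P n z * Complex.exp (Q n z) - 1
  have hud (n : ℕ) : Differentiable ℂ (u n) :=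
    ((hPd n).mul (hQd n).cexp).sub_const 1
  refine ⟨fun z ↦ ∏' n, (1 + u n z), differentiable_tprod_one_add hud hQb, fun z hz ↦ ?_,
    fun a ha ↦ ?_⟩
  · refine tprod_one_add_ne_zero_of_summable (fun n ↦ ?_)
      (summable_norm_of_norm_le_half_pow hQb z)
    simp only [u, add_sub_cancel]
    exact mul_ne_zero (hP0 n z fun a ha _ hza ↦ hz (hza ▸ ha)) (Complex.exp_ne_zero _)
  · let m := ⌊‖a‖⌋₊
    let v (n : ℕ) (z : ℂ) : ℂ := if n = m then 0 else u n z
    have hvd (n : ℕ) : Differentiable ℂ (v n) := by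
      by_cases h : n = m
      · simp [v, h]
      · simpa [v, h] using hud n
    have hvb (n : ℕ) (z : ℂ) (hz : ‖z‖ ≤ n - 1) : ‖v n z‖ ≤ (1 / 2) ^ n := by
      by_cases h : n = m
      · simp [v, h]
      · simpa [v, h] using hQb n z hz
    have ham : a ∈ (hfin m).toFinset := (hfin m).mem_toFinset.2 ⟨ha, rfl⟩
    refine ⟨fun z ↦ (∏ b ∈ (hfin m).toFinset.erase a, (z - b) ^ N b) * Complex.exp (Q m z) *
      ∏' n, (1 + v n z), ?_, fun z ↦ ?_⟩
    · have h1 := differentiable_tprod_one_add hvd hvb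
      have h2 := hQd m
      exact (Differentiable.mul (by fun_prop) h2.cexp).mul h1
    · have hm : Multipliable fun n ↦ (1 + v n z) :=
        multipliable_one_add_of_summable (summable_norm_of_norm_le_half_pow hvb z)
      have hupd : Function.update (fun n ↦ 1 + u n z) m 1 = fun n ↦ 1 + v n z := by
        ext n
        by_cases h : n = m <;> simp [v, h]
      have hite : (fun n ↦ if n = m then 1 else 1 + u n z) = fun n ↦ 1 + v n z := by
        ext n
        by_cases h : n = m <;> simp [v, h]
      have h1 := Multipliable.tprod_eq_mul_tprod_ite' m (hupd ▸ hm)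
      rw [hite] at h1
      refine h1.trans ?_
      simp only [u, add_sub_cancel, P, ← Finset.mul_prod_erase _ _ ham, mul_assoc]

/-- Weierstrass (1876): a function meromorphic on all of `ℂ` is a quotient of two
entire functions. -/
theorem meromorphic_eq_quotient_entire (f : ℂ → ℂ) (hf : ∀ z : ℂ, MeromorphicAt f z) :
    ∃ g h : ℂ → ℂ, Differentiable ℂ g ∧ Differentiable ℂ h ∧ (∃ z : ℂ, h z ≠ 0) ∧
      ∀ z : ℂ, h z ≠ 0 → f z = g z / h z := by
  have hS (R : ℝ) : (closedBall 0 R ∩ {z : ℂ | ¬ AnalyticAt ℂ f z}).Finite :=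
    (isCompact_closedBall (0 : ℂ) R).finite_sdiff_of_mem_codiscreteWithin
      (MeromorphicOn.eventually_codiscreteWithin_analyticAt f fun z _ ↦ hf z)
  choose N hN using hf
  obtain ⟨h, hd, h0, hk⟩ := exists_differentiable_forall_eq_pow_mul hS N
  refine ⟨fun z ↦ h z * f z, h, fun z ↦ ?_, hd, ?_, fun z hz ↦ by field_simp⟩
  · by_cases hz : AnalyticAt ℂ f z
    · exact (hd z).mul hz.differentiableAt
    · obtain ⟨k, hkd, hkz⟩ := hk z hz
      refine ((hkd z).mul (hN z).differentiableAt).congr_of_eventuallyEq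
        (Eventually.of_forall fun w ↦ ?_)
      simp only [hkz w, smul_eq_mul, Pi.mul_apply]
      ring
  · obtain ⟨z, hz⟩ := (MeromorphicAt.eventually_analyticAt ⟨N 0, hN 0⟩).exists
    exact ⟨z, h0 z (not_not.2 hz)⟩
end

section
/- For every nonzero complex number α that is algebraic over ℚ, the number e^α = exp(α) is transcendental over ℚ. -/
open Polynomial Filter Topology
open scoped Nat AddMonoidAlgebra

theorem isIntegral_pow_mul_aeval {K : Type*} [Field K] {a : ℤ} {x : K}
    (hx : IsIntegral ℤ ((a : K) * x)) (g : ℤ[X]) {N : ℕ} (hN : g.natDegree ≤ N) :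
    IsIntegral ℤ ((a : K) ^ N * aeval x g) := by
  rw [aeval_eq_sum_range, Finset.mul_sum]
  refine IsIntegral.sum _ fun i hi ↦ ?_
  have hi' : i ≤ N := (Finset.mem_range_succ_iff.mp hi).trans hN
  have h : (a : K) ^ N * g.coeff i • x ^ i =
      algebraMap ℤ K (g.coeff i * a ^ (N - i)) * ((a : K) * x) ^ i := by
    rw [← Nat.sub_add_cancel hi']
    simp [zsmul_eq_mul, pow_add, mul_pow]
    ring
  rw [h]
  exact isIntegral_algebraMap.mul (hx.pow i)

theorem exists_int_eq_of_isIntegral_of_fixed {K : Type*} [Field K] [Algebra ℚ K]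
    [FiniteDimensional ℚ K] [IsGalois ℚ K] {y : K} (hy : IsIntegral ℤ y)
    (hfix : ∀ σ : Gal(K/ℚ), σ y = y) : ∃ m : ℤ, (m : K) = y := by
  obtain ⟨r, rfl⟩ := (IsGalois.mem_range_algebraMap_iff_fixed y).mpr hfix
  rw [isIntegral_algebraMap_iff (algebraMap ℚ K).injective] at hy
  obtain ⟨m, rfl⟩ := IsIntegrallyClosed.isIntegral_iff.mp hy
  exact ⟨m, by simp⟩

theorem exists_int_eq_sum_aeval {K : Type*} [Field K] [Algebra ℚ K]
    [FiniteDimensional ℚ K] [IsGalois ℚ K] {S : Finset K} {c : K → ℤ}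
    (hS : ∀ (σ : Gal(K/ℚ)) x, x ∈ S → σ x ∈ S) (hc : ∀ (σ : Gal(K/ℚ)) x, c (σ x) = c x)
    {a : ℤ} (ha : ∀ x ∈ S, IsIntegral ℤ ((a : K) * x)) (g : ℤ[X]) {N : ℕ}
    (hN : g.natDegree ≤ N) :
    ∃ m : ℤ, (m : K) = (a : K) ^ N * ∑ x ∈ S, (c x : K) * aeval x g := by
  apply exists_int_eq_of_isIntegral_of_fixed
  · rw [Finset.mul_sum]
    refine IsIntegral.sum _ fun x hx ↦ ?_
    rw [mul_left_comm]
    exact (isIntegral_algebraMap (R := ℤ) (x := c x)).mul (isIntegral_pow_mul_aeval (ha x hx) g hN)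
  · intro σ
    simp only [map_mul, map_pow, map_intCast, map_sum]
    congr 1
    refine Finset.sum_bij (fun x _ ↦ σ x) (hS σ) (fun x _ y _ h ↦ σ.injective h)
      (fun y hy ↦ ⟨σ⁻¹ y, hS _ y hy, AlgEquiv.apply_symm_apply σ y⟩) fun x _ ↦ ?_
    rw [hc]
    congr 1
    exact (aeval_algHom_apply ((σ : K →ₐ[ℚ] K).restrictScalars ℤ) x g).symm

theorem exists_int_polynomial_aeval_eq_zero {K : Type*} [Field K] [Algebra ℚ K]
    [FiniteDimensional ℚ K] {S : Finset K} (h0 : (0 : K) ∉ S) :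
    ∃ f : ℤ[X], f.eval 0 ≠ 0 ∧ ∀ x ∈ S, aeval x f = 0 := by
  have key : ∀ x : K, ∃ p : ℤ[X], x ≠ 0 → p.coeff 0 ≠ 0 ∧ aeval x p = 0 := fun x ↦ by
    by_cases hx : x = 0
    · exact ⟨0, fun h ↦ absurd hx h⟩
    · have halg : IsAlgebraic ℤ x :=
        (IsFractionRing.isAlgebraic_iff ℤ ℚ K).mpr (Algebra.IsAlgebraic.isAlgebraic x)
      obtain ⟨p, hp⟩ := halg.exists_nonzero_coeff_and_aeval_eq_zero
        (mem_nonZeroDivisors_of_ne_zero hx)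
      exact ⟨p, fun _ ↦ hp⟩
  choose p hp using key
  have hne : ∀ x ∈ S, x ≠ 0 := fun x hx h ↦ h0 (h ▸ hx)
  refine ⟨∏ x ∈ S, p x, ?_, fun x hx ↦ ?_⟩
  · rw [eval_prod, Finset.prod_ne_zero_iff]
    intro x hx
    rw [← coeff_zero_eq_eval_zero]
    exact (hp x (hne x hx)).1
  · rw [map_prod]
    exact Finset.prod_eq_zero hx (hp x (hne x hx)).2

theorem add_sum_mul_exp_ne_zero {K : Type*} [Field K] [Algebra ℚ K]
    [FiniteDimensional ℚ K] [IsGalois ℚ K] (ι : K →+* ℂ) {S : Finset K} {c : K → ℤ}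
    (hS : ∀ (σ : Gal(K/ℚ)) x, x ∈ S → σ x ∈ S) (hc : ∀ (σ : Gal(K/ℚ)) x, c (σ x) = c x)
    (h0 : (0 : K) ∉ S) {w : ℤ} (hw : w ≠ 0) :
    (w : ℂ) + ∑ x ∈ S, (c x : ℂ) * Complex.exp (ι x) ≠ 0 := by
  intro hsum
  obtain ⟨f, hf0, hf⟩ := exists_int_polynomial_aeval_eq_zero h0
  have : Algebra.IsAlgebraic ℤ K := (IsFractionRing.comap_isAlgebraic_iff (A := ℤ) (K := ℚ)).mpr
    inferInstance
  obtain ⟨a, ha0, ha⟩ := Algebra.IsAlgebraic.exists_integral_multiples (R := ℤ) (A := K) S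
  have hroot : ∀ x ∈ S, ι x ∈ f.aroots ℂ := fun x hx ↦ by
    rw [mem_aroots]
    refine ⟨fun h ↦ hf0 (by simp [h]), ?_⟩
    rw [← RingHom.toIntAlgHom_apply ι x, aeval_algHom_apply, hf x hx, map_zero]
  obtain ⟨M, hM⟩ := LindemannWeierstrass.exp_polynomial_approx f hf0
  set d := f.natDegree
  set C : ℝ := ∑ x ∈ S, |(c x : ℝ)|
  have hlim : Tendsto (fun n : ℕ ↦ C * |(a : ℝ)| ^ d * ((|(a : ℝ)| ^ d * M) ^ n / n ! * M))
      atTop (𝓝 0) := by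
    simpa using ((FloorSemiring.tendsto_pow_div_factorial_atTop (|(a : ℝ)| ^ d * M)).mul_const
      M).const_mul (C * |(a : ℝ)| ^ d)
  obtain ⟨n₀, hn₀⟩ := eventually_atTop.mp (hlim.eventually_lt_const one_pos)
  obtain ⟨p, hpge, hp⟩ := Nat.exists_infinite_primes
    (n₀ + (f.eval 0).natAbs + a.natAbs + w.natAbs + 1)
  obtain ⟨n, hpn, g, hgdeg, hg⟩ := hM p (by omega) hp
  obtain ⟨m, hm⟩ := exists_int_eq_sum_aeval hS hc
    (fun x hx ↦ by simpa [zsmul_eq_mul] using ha x hx) g (hgdeg.trans (Nat.sub_le _ 1))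
  have hm' : (m : ℂ) = (a : ℂ) ^ (p * d) * ∑ x ∈ S, (c x : ℂ) * aeval (ι x) g := by
    have := congrArg ι hm
    simp only [map_mul, map_pow, map_intCast, map_sum] at this
    rw [this]
    congr 1
    refine Finset.sum_congr rfl fun x _ ↦ ?_
    congr 1
    exact (aeval_algHom_apply ι.toIntAlgHom x g).symm
  have hdvd : ¬ (p : ℤ) ∣ a ^ (p * d) * (n * w) + p * m := by
    have hpz := Nat.prime_iff_prime_int.mp hp
    have hsmall : ∀ b : ℤ, b ≠ 0 → b.natAbs < p → ¬ (p : ℤ) ∣ b := fun b hb hlt h ↦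
      absurd (Nat.le_of_dvd (Int.natAbs_pos.mpr hb) (Int.natCast_dvd.mp h)) (by omega)
    rw [dvd_add_left (dvd_mul_right _ _)]
    intro h
    rcases hpz.dvd_or_dvd h with h | h
    · exact hsmall a ha0 (by omega) (hpz.dvd_of_dvd_pow h)
    · rcases hpz.dvd_or_dvd h with h | h
      · exact hpn h
      · exact hsmall w hw (by omega) h
  have hone : (1 : ℝ) ≤ ‖((a ^ (p * d) * (n * w) + p * m : ℤ) : ℂ)‖ := by
    rw [Complex.norm_intCast]
    have hne : a ^ (p * d) * (n * w) + p * m ≠ 0 := fun h ↦ hdvd (by simp [h])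
    exact_mod_cast Int.one_le_abs hne
  have heq : ((a ^ (p * d) * (n * w) + p * m : ℤ) : ℂ) =
      -((a : ℂ) ^ (p * d) * ∑ x ∈ S, (c x : ℂ) * (n • Complex.exp (ι x) - p • aeval (ι x) g)) := by
    have hw' : (w : ℂ) = -∑ x ∈ S, (c x : ℂ) * Complex.exp (ι x) := eq_neg_of_add_eq_zero_left hsum
    push_cast
    rw [hm', hw']
    simp only [mul_sub, Finset.sum_sub_distrib, zsmul_eq_mul, nsmul_eq_mul,
      mul_left_comm (c _ : ℂ), ← Finset.mul_sum]
    ring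
  have hle : ‖((a ^ (p * d) * (n * w) + p * m : ℤ) : ℂ)‖ ≤
      |(a : ℝ)| ^ (p * d) * (C * (M ^ p / (p - 1)!)) := by
    rw [heq, norm_neg, norm_mul, norm_pow, Complex.norm_intCast, Finset.sum_mul]
    gcongr
    refine norm_sum_le_of_le _ fun x hx ↦ ?_
    rw [norm_mul, Complex.norm_intCast]
    gcongr
    exact hg (hroot x hx)
  have hlt := hn₀ (p - 1) (by omega)
  have hpow : C * |(a : ℝ)| ^ d * ((|(a : ℝ)| ^ d * M) ^ (p - 1) / (p - 1)! * M) =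
      |(a : ℝ)| ^ (p * d) * (C * (M ^ p / (p - 1)!)) := by
    obtain ⟨k, rfl⟩ : ∃ k, p = k + 1 := ⟨p - 1, by omega⟩
    simp only [Nat.add_sub_cancel]
    rw [mul_pow, ← pow_mul, add_mul, pow_add, mul_comm d k, one_mul, pow_succ]
    ring
  linarith

theorem AddMonoidAlgebra.aeval_single_ne_zero {K : Type*} [AddCommGroup K] [IsAddTorsionFree K]
    {x : K} (hx : x ≠ 0) {q : ℤ[X]} (hq : q ≠ 0) :
    aeval (AddMonoidAlgebra.single x 1 : ℤ[K]) q ≠ 0 := by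
  classical
  intro h
  apply Polynomial.leadingCoeff_ne_zero.mpr hq
  have := congrArg (fun F : ℤ[K] ↦ F.coeff (q.natDegree • x)) h
  have hinj : ∀ m n : ℕ, m • x = n • x ↔ m = n := fun m n ↦ by
    simpa using (smul_left_injective ℤ hx).eq_iff (a := (m : ℤ)) (b := n)
  simpa [aeval_eq_sum_range, AddMonoidAlgebra.single_pow, AddMonoidAlgebra.coeff_sum,
    Finsupp.single_apply, hinj, -leadingCoeff_eq_zero] using this

/-- The evaluation `[x] ↦ exp (ι x)` on the integral group algebra of the additive group of `K`. -/
noncomputable def expEval {K : Type*} [Field K] (ι : K →+* ℂ) : ℤ[K] →ₐ[ℤ] ℂ :=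
  AddMonoidAlgebra.lift ℤ ℂ K
    (Complex.expMonoidHom.comp (AddMonoidHom.toMultiplicative (ι : K →+ ℂ)))

theorem expEval_single {K : Type*} [Field K] (ι : K →+* ℂ) (x : K) (n : ℤ) :
    expEval ι (AddMonoidAlgebra.single x n) = n * Complex.exp (ι x) := by
  simp [expEval, AddMonoidAlgebra.lift_single]

theorem expEval_apply {K : Type*} [Field K] (ι : K →+* ℂ) (H : ℤ[K]) :
    expEval ι H = ∑ x ∈ H.coeff.support, (H.coeff x : ℂ) * Complex.exp (ι x) := by
  simp [expEval, AddMonoidAlgebra.lift_apply, Finsupp.sum]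

theorem expEval_ne_zero_of_coeff_zero_ne_zero {K : Type*} [Field K] [Algebra ℚ K]
    [FiniteDimensional ℚ K] [IsGalois ℚ K] (ι : K →+* ℂ) {H : ℤ[K]}
    (hH : ∀ (σ : Gal(K/ℚ)) x, H.coeff (σ x) = H.coeff x) (h0 : H.coeff 0 ≠ 0) :
    expEval ι H ≠ 0 := by
  classical
  have h := add_sum_mul_exp_ne_zero ι (S := H.coeff.support.erase 0) (c := H.coeff)
    (fun σ x hx ↦ by simpa [hH] using hx) hH (by simp) h0
  rw [expEval_apply, ← Finset.add_sum_erase _ _ (Finsupp.mem_support_iff.mpr h0)]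
  simpa using h

theorem expEval_ne_zero_of_invariant {K : Type*} [Field K] [Algebra ℚ K]
    [FiniteDimensional ℚ K] [IsGalois ℚ K] (ι : K →+* ℂ) {F : ℤ[K]}
    (hF : ∀ (σ : Gal(K/ℚ)) x, F.coeff (σ x) = F.coeff x) (h0 : F ≠ 0) :
    expEval ι F ≠ 0 := by
  classical
  obtain ⟨b, hb⟩ : ∃ b, F.coeff b ≠ 0 := by
    by_contra! h
    exact h0 (by ext x; simp [h x])
  set H : ℤ[K] := F * ∑ τ : Gal(K/ℚ), AddMonoidAlgebra.single (-τ b) 1 with hHdef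
  have hcoeff : ∀ x, H.coeff x = ∑ τ : Gal(K/ℚ), F.coeff (x + τ b) := fun x ↦ by
    simp [hHdef, Finset.mul_sum, AddMonoidAlgebra.coeff_sum]
  have hH : expEval ι H ≠ 0 := by
    apply expEval_ne_zero_of_coeff_zero_ne_zero
    · intro σ x
      rw [hcoeff, hcoeff, ← Equiv.sum_comp (Equiv.mulLeft σ)]
      refine Finset.sum_congr rfl fun τ _ ↦ ?_
      rw [← hF σ (x + τ b), map_add σ]
      rfl
    · simpa [hcoeff, hF] using hb
  rw [hHdef, map_mul] at hH
  exact left_ne_zero_of_mul hH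

theorem aeval_exp_ne_zero {K : Type*} [Field K] [Algebra ℚ K]
    [FiniteDimensional ℚ K] [IsGalois ℚ K] (ι : K →+* ℂ) {x : K} (hx : x ≠ 0) {q : ℤ[X]}
    (hq : q ≠ 0) : aeval (Complex.exp (ι x)) q ≠ 0 := by
  classical
  have : CharZero K := algebraRat.charZero K
  let G : Gal(K/ℚ) → ℤ[K] := fun σ ↦ aeval (AddMonoidAlgebra.single (σ x) 1) q
  have hG : expEval ι (∏ σ, G σ) ≠ 0 := by
    apply expEval_ne_zero_of_invariant
    · intro σ y
      have hinv : AddMonoidAlgebra.domCongr ℤ ℤ (σ : K ≃+ K) (∏ τ, G τ) = ∏ τ, G τ := by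
        rw [map_prod, ← Equiv.prod_comp (Equiv.mulLeft σ) G]
        refine Finset.prod_congr rfl fun τ _ ↦ ?_
        simp only [G]
        rw [← AlgEquiv.coe_toAlgHom, ← aeval_algHom_apply]
        simp only [AddMonoidAlgebra.domCongr_single, AlgEquiv.coe_toAlgHom]
        rfl
      conv_lhs => rw [← hinv]
      rw [AddMonoidAlgebra.coeff_domCongr]
      exact congrArg _ (σ.symm_apply_apply y)
    · exact Finset.prod_ne_zero_iff.mpr fun σ _ ↦
        AddMonoidAlgebra.aeval_single_ne_zero (by simpa using hx) hq
  rw [map_prod, Finset.prod_ne_zero_iff] at hG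
  simpa [G, ← aeval_algHom_apply, expEval_single] using hG 1 (Finset.mem_univ _)

/-- Lindemann (1882): for every nonzero algebraic complex number `α`,
`exp α` is transcendental over `ℚ`. -/
theorem lindemann_exp_transcendental (α : ℂ) (hα : α ≠ 0) (halg : IsAlgebraic ℚ α) :
    Transcendental ℚ (Complex.exp α) := by
  let L := IntermediateField.adjoin ℚ ((minpoly ℚ α).rootSet ℂ)
  have hmem : α ∈ L := IntermediateField.subset_adjoin _ _ <|
    mem_rootSet.mpr ⟨minpoly.ne_zero halg.isIntegral, minpoly.aeval ℚ α⟩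
  have : IsSplittingField ℚ L (minpoly ℚ α) :=
    IntermediateField.adjoin_rootSet_isSplittingField (IsAlgClosed.splits _)
  have : FiniteDimensional ℚ L := IsSplittingField.finiteDimensional L (minpoly ℚ α)
  have : Normal ℚ L := Normal.of_isSplittingField (minpoly ℚ α)
  have : IsGalois ℚ L := { }
  rw [Transcendental, ← IsFractionRing.isAlgebraic_iff ℤ ℚ ℂ]
  rintro ⟨q, hq, hq0⟩
  exact aeval_exp_ne_zero (algebraMap L ℂ) (x := ⟨α, hmem⟩) (by simpa [Subtype.ext_iff] using hα)
    hq hq0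
end

section
/- The real number e (the base of the natural logarithm, e = exp 1) is transcendental over ℚ. -/
open Polynomial in
/-- No integer polynomial with nonzero constant coefficient vanishes at `e`. -/
theorem aeval_cexp_one_ne_zero (q : ℤ[X]) (hq : q.coeff 0 ≠ 0) :
    aeval (Complex.exp 1) q ≠ 0 := by
  intro hroot
  set d := q.natDegree
  let f : ℤ[X] := ∏ k ∈ Finset.range d, (X - C ((k : ℤ) + 1))
  have hf : f.eval 0 ≠ 0 := by
    simp only [f, eval_prod, eval_sub, eval_X, eval_C, Finset.prod_ne_zero_iff]
    intro k _
    lia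
  have hf0 : f ≠ 0 := by
    rintro h
    simp [h] at hf
  have hf_root : ∀ k ∈ Finset.range d, ((k + 1 : ℤ) : ℂ) ∈ f.aroots ℂ := by
    intro k hk
    rw [mem_aroots]
    refine ⟨hf0, ?_⟩
    rw [map_prod]
    exact Finset.prod_eq_zero hk (by simp)
  obtain ⟨c, hc⟩ := LindemannWeierstrass.exp_polynomial_approx f hf
  let S : ℝ := ∑ k ∈ Finset.range d, |(q.coeff (k + 1) : ℝ)|
  have hsmall : ∀ᶠ p : ℕ in Filter.atTop, S * c ^ p / (p - 1).factorial < 1 :=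
    (FloorSemiring.tendsto_mul_pow_div_factorial_sub_atTop S c 1).eventually_lt_const one_pos
  obtain ⟨p, hp, hsp, hpf, hpq⟩ := (Nat.frequently_atTop_iff_infinite.mpr
    Nat.infinite_setOfPred_prime).and_eventually (hsmall.and
      ((Filter.eventually_gt_atTop (f.eval 0).natAbs).and
        (Filter.eventually_gt_atTop (q.coeff 0).natAbs))) |>.exists
  obtain ⟨n, hn, g, -, hg⟩ := hc p hpf hp
  let N : ℤ := n * q.coeff 0 + p * ∑ k ∈ Finset.range d, q.coeff (k + 1) * g.eval ((k : ℤ) + 1)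
  have hN : (N : ℂ) = -∑ k ∈ Finset.range d, (q.coeff (k + 1) : ℂ) *
      (n • Complex.exp ((k + 1 : ℤ) : ℂ) - p • aeval ((k + 1 : ℤ) : ℂ) g) := by
    have hexp : (n : ℂ) * q.coeff 0 =
        -∑ k ∈ Finset.range d, (q.coeff (k + 1) : ℂ) * (n * Complex.exp ((k + 1 : ℤ) : ℂ)) := by
      rw [aeval_eq_sum_range, Finset.sum_range_succ'] at hroot
      have := congrArg (fun z => (n : ℂ) * z) hroot
      simp only [mul_add, Finset.mul_sum, mul_zero, pow_zero, zsmul_eq_mul, mul_one] at this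
      rw [eq_neg_iff_add_eq_zero, add_comm, ← this]
      congr 1
      refine Finset.sum_congr rfl fun k _ => ?_
      rw [← Complex.exp_nat_mul]
      push_cast
      ring_nf
    have hint (k : ℕ) : aeval ((k + 1 : ℤ) : ℂ) g = ((g.eval ((k : ℤ) + 1) : ℤ) : ℂ) := by
      rw [← eq_intCast (algebraMap ℤ ℂ), aeval_algebraMap_apply_eq_algebraMap_eval,
        eq_intCast]
    simp only [N, hint, zsmul_eq_mul, nsmul_eq_mul, mul_sub, Finset.sum_sub_distrib]
    push_cast at hexp ⊢
    rw [hexp, neg_sub', sub_neg_eq_add, Finset.mul_sum]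
    congr 1
    exact Finset.sum_congr rfl fun k _ => by ring
  have hN_lt : ‖(N : ℂ)‖ < 1 := by
    refine lt_of_le_of_lt ?_ hsp
    rw [hN, norm_neg, mul_div_assoc, Finset.sum_mul]
    refine (norm_sum_le _ _).trans (Finset.sum_le_sum fun k hk => ?_)
    rw [norm_mul, Complex.norm_intCast]
    exact mul_le_mul_of_nonneg_left (hg (hf_root k hk)) (abs_nonneg _)
  have hN0 : N = 0 := by
    rw [Complex.norm_intCast] at hN_lt
    exact Int.abs_lt_one_iff.mp (by exact_mod_cast hN_lt)
  have hdvd : (p : ℤ) ∣ n * q.coeff 0 :=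
    (dvd_add_left (dvd_mul_right _ _)).mp (hN0 ▸ dvd_zero (p : ℤ))
  rcases Int.Prime.dvd_mul' hp hdvd with h | h
  · exact hn h
  · exact hpq.not_ge (Nat.le_of_dvd (Int.natAbs_pos.mpr hq) (Int.natCast_dvd.mp h))

/-- The number `e = exp 1` is transcendental over `ℚ`. -/
theorem e_transcendental : Transcendental ℚ (Real.exp 1) := by
  intro h
  obtain ⟨q, hq, hroot⟩ := ((IsFractionRing.isAlgebraic_iff ℤ ℚ ℝ).mpr
    h).exists_nonzero_coeff_and_aeval_eq_zero
      (mem_nonZeroDivisors_of_ne_zero (Real.exp_ne_zero 1))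
  refine aeval_cexp_one_ne_zero q hq ?_
  have := Polynomial.aeval_algebraMap_apply ℂ (Real.exp 1) q
  simpa [hroot] using this
end

section
/- Let α₁, …, αₙ be distinct complex numbers, each algebraic over ℚ, and let c₁, …, cₙ be complex numbers algebraic over ℚ, not all zero. Then c₁·e^{α₁} + c₂·e^{α₂} + … + cₙ·e^{αₙ} ≠ 0; that is, the exponentials of distinct algebraic numbers are linearly independent over the field of algebraic numbers. -/
namespace LindemannWeierstrass

open Polynomial AddMonoidAlgebra Filter
open scoped Nat

/-- Clearing denominators in the value of an integer polynomial at a root of `f`. -/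
theorem isIntegral_leadingCoeff_pow_mul_aeval {A : Type*} [CommRing A] {f g : ℤ[X]} {x : A}
    (hx : aeval x f = 0) {m : ℕ} (hm : g.natDegree ≤ m) :
    IsIntegral ℤ ((f.leadingCoeff : A) ^ m * aeval x g) := by
  have hk : IsIntegral ℤ ((f.leadingCoeff : A) * x) := by
    simpa [zsmul_eq_mul] using isIntegral_leadingCoeff_smul f x hx
  rw [aeval_eq_sum_range' (Nat.lt_succ_of_le hm), Finset.mul_sum]
  refine IsIntegral.sum _ fun i hi ↦ ?_
  have hi : i ≤ m := Nat.lt_succ_iff.mp (Finset.mem_range.mp hi)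
  have : (f.leadingCoeff : A) ^ m * g.coeff i • x ^ i =
      ((f.leadingCoeff ^ (m - i) * g.coeff i : ℤ) : A) * ((f.leadingCoeff : A) * x) ^ i := by
    rw [← Nat.sub_add_cancel hi, pow_add, zsmul_eq_mul, mul_pow]
    push_cast [Nat.sub_add_cancel hi]
    ring
  rw [this]
  exact IsIntegral.mul (isIntegral_algebraMap (R := ℤ) (A := A)) (hk.pow i)

/-- A Galois-invariant algebraic integer is a rational integer. -/
theorem exists_int_cast_eq_of_forall_galois {K : Type*} [Field K] [NumberField K] [IsGalois ℚ K]
    {x : K} (hx : IsIntegral ℤ x) (hfix : ∀ σ : K ≃ₐ[ℚ] K, σ x = x) : ∃ z : ℤ, (z : K) = x := by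
  obtain ⟨r, rfl⟩ := (IsGalois.mem_range_algebraMap_iff_fixed x).mpr hfix
  rw [isIntegral_algebraMap_iff (algebraMap ℚ K).injective] at hx
  obtain ⟨z, rfl⟩ := IsIntegrallyClosed.isIntegral_iff.mp hx
  exact ⟨z, by simp⟩

/-- Finitely many nonzero algebraic numbers are roots of a single integer polynomial with nonzero
constant term. -/
theorem exists_polynomial_eval_zero_ne_zero {K : Type*} [Field K] [NumberField K] (S : Finset K)
    (hS : 0 ∉ S) : ∃ f : ℤ[X], f.eval 0 ≠ 0 ∧ ∀ a ∈ S, aeval a f = 0 := by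
  have (a : K) : ∃ q : ℤ[X], q.eval 0 ≠ 0 ∧ (a ≠ 0 → aeval a q = 0) := by
    by_cases ha : a = 0
    · exact ⟨1, by simp, fun h ↦ (h ha).elim⟩
    · have halg : IsAlgebraic ℤ a :=
        (IsFractionRing.isAlgebraic_iff ℤ ℚ K).mpr (Algebra.IsAlgebraic.isAlgebraic a)
      obtain ⟨q, hq, hqa⟩ := halg.exists_nonzero_coeff_and_aeval_eq_zero
        (mem_nonZeroDivisors_of_ne_zero ha)
      exact ⟨q, by rwa [← coeff_zero_eq_eval_zero], fun _ ↦ hqa⟩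
  choose q hq hqa using this
  refine ⟨∏ a ∈ S, q a, ?_, fun a ha ↦ ?_⟩
  · rw [eval_prod]
    exact Finset.prod_ne_zero_iff.mpr fun a _ ↦ hq a
  · rw [map_prod]
    exact Finset.prod_eq_zero ha (hqa a (ne_of_mem_of_not_mem ha hS))

/-- Factorials eventually dominate exponentials. -/
theorem eventually_mul_pow_div_factorial_lt_one (A B : ℝ) :
    ∀ᶠ p : ℕ in atTop, A * (B ^ p / (p - 1)!) < 1 := by
  have h : Tendsto (fun n : ℕ ↦ A * (B * (B ^ n / n !))) atTop (nhds (A * (B * 0))) :=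
    ((FloorSemiring.tendsto_pow_div_factorial_atTop B).const_mul B).const_mul A
  rw [mul_zero, mul_zero] at h
  have h1 := (tendsto_sub_atTop_nat 1).eventually (h.eventually_lt_const one_pos)
  filter_upwards [h1, eventually_ge_atTop 1] with p hp hp1
  obtain ⟨n, rfl⟩ := Nat.exists_eq_add_of_le' hp1
  simpa [pow_succ', mul_div_assoc] using hp

/-- The arithmetic core: a finitely supported family of algebraic integers on a Galois number
field, equivariant under the Galois group, with nonzero value at `0`, gives a nonzero exponential
sum. -/
theorem sum_mul_exp_ne_zero_of_isIntegral {K : Type*} [Field K] [NumberField K] [IsGalois ℚ K]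
    [Algebra K ℂ] (c : K →₀ K) (hcint : ∀ a, IsIntegral ℤ (c a))
    (hinv : ∀ (σ : K ≃ₐ[ℚ] K) (a : K), c (σ a) = σ (c a)) (h0 : c 0 ≠ 0) :
    c.sum (fun a b ↦ algebraMap K ℂ b * Complex.exp (algebraMap K ℂ a)) ≠ 0 := by
  classical
  intro hsum
  set S := c.support.erase 0 with hS
  obtain ⟨w, hw⟩ := exists_int_cast_eq_of_forall_galois (hcint 0)
    fun σ ↦ by simpa using (hinv σ 0).symm
  have hw0 : w ≠ 0 := by rintro rfl; exact h0 (by simpa using hw.symm)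
  have hsum' : (w : ℂ) + ∑ a ∈ S, algebraMap K ℂ (c a) * Complex.exp (algebraMap K ℂ a) = 0 := by
    rw [← hsum, Finsupp.sum, ← Finset.add_sum_erase _ _ (Finsupp.mem_support_iff.mpr h0), ← hw]
    simp [hS]
  obtain ⟨f, hf0, hfS⟩ := exists_polynomial_eval_zero_ne_zero S (by simp [hS])
  have hf : f ≠ 0 := by rintro rfl; simp at hf0
  set k := f.leadingCoeff with hk
  have hk0 : k ≠ 0 := leadingCoeff_ne_zero.mpr hf
  obtain ⟨C, hC⟩ := exp_polynomial_approx f hf0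
  set M := ∑ a ∈ S, ‖algebraMap K ℂ (c a)‖ with hM
  obtain ⟨p, ⟨hpsmall, hpf, hpk, hpw⟩, hp⟩ :=
    (Nat.frequently_atTop_iff_infinite.mpr Nat.infinite_setOfPred_prime).and_eventually
      ((eventually_mul_pow_div_factorial_lt_one M (|(k : ℝ)| ^ f.natDegree * C)).and
        ((eventually_gt_atTop (f.eval 0).natAbs).and
          ((eventually_gt_atTop k.natAbs).and (eventually_gt_atTop w.natAbs)))) |>.exists.imp
      fun p h ↦ And.symm h
  obtain ⟨n, hn, g, hg, hgr⟩ := hC p hpf hp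
  set m := p * f.natDegree with hm
  obtain ⟨z, hz⟩ : ∃ z : ℤ, (z : K) = ∑ a ∈ S, c a * ((k : K) ^ m * aeval a g) := by
    refine exists_int_cast_eq_of_forall_galois (IsIntegral.sum _ fun a ha ↦ (hcint a).mul
      (isIntegral_leadingCoeff_pow_mul_aeval (hfS a ha) (hg.trans (Nat.sub_le _ _)))) fun σ ↦ ?_
    rw [map_sum]
    refine Finset.sum_equiv σ.toEquiv (fun a ↦ ?_) fun a _ ↦ ?_
    · simp [hS, hinv]
    · have : aeval (σ a) g = σ (aeval a g) :=
        aeval_algHom_apply ((σ : K →ₐ[ℚ] K).restrictScalars ℤ) a g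
      simp [hinv, this]
  have hzC : (z : ℂ) = ∑ a ∈ S, algebraMap K ℂ (c a) *
      ((k : ℂ) ^ m * aeval (algebraMap K ℂ a) g) := by
    have := congrArg (algebraMap K ℂ) hz
    simpa [aeval_algebraMap_apply] using this
  have hN : ((k ^ m * (n * w) + p * z : ℤ) : ℂ) = -((k : ℂ) ^ m * ∑ a ∈ S,
      algebraMap K ℂ (c a) *
        (n • Complex.exp (algebraMap K ℂ a) - p • aeval (algebraMap K ℂ a) g)) := by
    have e1 : ∑ a ∈ S, algebraMap K ℂ (c a) *
        (n • Complex.exp (algebraMap K ℂ a) - p • aeval (algebraMap K ℂ a) g) =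
        n * ∑ a ∈ S, algebraMap K ℂ (c a) * Complex.exp (algebraMap K ℂ a) -
        p * ∑ a ∈ S, algebraMap K ℂ (c a) * aeval (algebraMap K ℂ a) g := by
      rw [Finset.mul_sum, Finset.mul_sum, ← Finset.sum_sub_distrib]
      refine Finset.sum_congr rfl fun a _ ↦ ?_
      simp only [zsmul_eq_mul, nsmul_eq_mul]
      ring
    have e2 : (z : ℂ) = (k : ℂ) ^ m * ∑ a ∈ S, algebraMap K ℂ (c a) *
        aeval (algebraMap K ℂ a) g := by
      rw [hzC, Finset.mul_sum]
      exact Finset.sum_congr rfl fun a _ ↦ by ring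
    rw [e1]
    push_cast
    rw [e2]
    linear_combination (k : ℂ) ^ m * n * hsum'
  have hlt : ‖((k ^ m * (n * w) + p * z : ℤ) : ℂ)‖ < 1 := by
    rw [hN, norm_neg, norm_mul, norm_pow, Complex.norm_intCast]
    refine lt_of_le_of_lt ?_ hpsmall
    calc |(k : ℝ)| ^ m * _ ≤ |(k : ℝ)| ^ m * ∑ a ∈ S,
          ‖algebraMap K ℂ (c a)‖ * (C ^ p / (p - 1)!) := by
          gcongr
          refine norm_sum_le_of_le _ fun a ha ↦ ?_
          rw [norm_mul]
          gcongr
          refine hgr ((mem_aroots.mpr ⟨hf, ?_⟩))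
          rw [aeval_algebraMap_apply, hfS a ha, map_zero]
      _ = _ := by
          rw [← Finset.sum_mul, ← hM, mul_pow, ← pow_mul, hm, mul_comm p]
          ring
  have hzero : k ^ m * (n * w) + p * z = 0 := by
    rw [Complex.norm_intCast] at hlt
    exact Int.abs_lt_one_iff.mp (by exact_mod_cast hlt)
  have hdvd : (p : ℤ) ∣ k ^ m * (n * w) :=
    (dvd_add_left (dvd_mul_right (p : ℤ) z)).mp (hzero ▸ dvd_zero _)
  have hnot {x : ℤ} (hx : x ≠ 0) (hxp : x.natAbs < p) : ¬ (p : ℤ) ∣ x := fun h ↦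
    (Nat.le_of_dvd (Int.natAbs_pos.mpr hx) (Int.natCast_dvd.mp h)).not_gt hxp
  have hp' : Prime (p : ℤ) := Nat.prime_iff_prime_int.mp hp
  rcases hp'.dvd_or_dvd hdvd with h | h
  · exact hnot hk0 hpk (hp'.dvd_of_dvd_pow h)
  · exact (hp'.dvd_or_dvd h).elim hn (hnot hw0 hpw)

/-- A Galois-equivariant exponential sum with nonzero value at `0` does not vanish. -/
theorem sum_mul_exp_ne_zero_of_equivariant {K : Type*} [Field K] [NumberField K] [IsGalois ℚ K]
    [Algebra K ℂ] (c : K →₀ K) (hinv : ∀ (σ : K ≃ₐ[ℚ] K) (a : K), c (σ a) = σ (c a))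
    (h0 : c 0 ≠ 0) :
    c.sum (fun a b ↦ algebraMap K ℂ b * Complex.exp (algebraMap K ℂ a)) ≠ 0 := by
  classical
  have : Algebra.IsAlgebraic ℤ K :=
    (IsFractionRing.comap_isAlgebraic_iff (A := ℤ) (K := ℚ)).mpr inferInstance
  obtain ⟨y, hy, hcint⟩ := Algebra.IsAlgebraic.exists_integral_multiples ℤ (c.support.image c)
  have hyK : (y : K) ≠ 0 := Int.cast_ne_zero.mpr hy
  have key := sum_mul_exp_ne_zero_of_isIntegral ((y : K) • c) (fun a ↦ ?_)
    (fun σ a ↦ by simp [hinv]) (by simp [hyK, h0])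
  · intro h
    apply key
    rw [Finsupp.sum_smul_index (by simp)]
    simp only [map_mul, mul_assoc, map_intCast]
    rw [← Finsupp.mul_sum, h, mul_zero]
  · by_cases ha : c a = 0
    · simp [ha, isIntegral_zero]
    · simpa using hcint (c a) (Finset.mem_image_of_mem _ (Finsupp.mem_support_iff.mpr ha))

/-- The ring homomorphism `∑ b • [a] ↦ ∑ b * exp a`. -/
noncomputable def expEval (K : Type*) [Field K] [Algebra K ℂ] : AddMonoidAlgebra K K →+* ℂ :=
  liftNCRingHom (algebraMap K ℂ)
    (Complex.expMonoidHom.comp (AddMonoidHom.toMultiplicative (algebraMap K ℂ).toAddMonoidHom))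
    fun _ _ ↦ mul_comm _ _

theorem expEval_apply {K : Type*} [Field K] [Algebra K ℂ] (F : AddMonoidAlgebra K K) :
    expEval K F = F.coeff.sum fun a b ↦ algebraMap K ℂ b * Complex.exp (algebraMap K ℂ a) :=
  rfl

/-- The action of an automorphism of `K` on both the coefficients and the exponents. -/
noncomputable def diagMap {K : Type*} [Field K] [Algebra ℚ K] (σ : K ≃ₐ[ℚ] K) :
    AddMonoidAlgebra K K ≃+* AddMonoidAlgebra K K :=
  (mapRingEquiv K σ.toRingEquiv).trans (mapDomainRingEquiv K σ.toAddEquiv)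

theorem diagMap_single {K : Type*} [Field K] [Algebra ℚ K] (σ : K ≃ₐ[ℚ] K) (a b : K) :
    diagMap σ (single a b) = single (σ a) (σ b) := by
  simp [diagMap]

theorem coeff_diagMap {K : Type*} [Field K] [Algebra ℚ K] (σ : K ≃ₐ[ℚ] K)
    (F : AddMonoidAlgebra K K) (a : K) : (diagMap σ F).coeff (σ a) = σ (F.coeff a) := by
  simp [diagMap, Finsupp.equivMapDomain_apply]

theorem diagMap_mul {K : Type*} [Field K] [Algebra ℚ K] (σ τ : K ≃ₐ[ℚ] K)
    (F : AddMonoidAlgebra K K) : diagMap (σ * τ) F = diagMap σ (diagMap τ F) := by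
  induction F using AddMonoidAlgebra.induction_linear with
  | zero => simp
  | add F G hF hG => simp [hF, hG]
  | single a b => simp [diagMap_single]

theorem diagMap_one {K : Type*} [Field K] [Algebra ℚ K]
    (F : AddMonoidAlgebra K K) : diagMap (1 : K ≃ₐ[ℚ] K) F = F := by
  induction F using AddMonoidAlgebra.induction_linear with
  | zero => simp
  | add F G hF hG => simp [hF, hG]
  | single a b => simp [diagMap_single]

/-- Exponentials of distinct elements of a Galois number field are linearly independent over it. -/
theorem expEval_injective (K : Type*) [Field K] [NumberField K] [IsGalois ℚ K] [Algebra K ℂ] :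
    Function.Injective (expEval K) := by
  classical
  rw [injective_iff_map_eq_zero]
  intro F hF
  by_contra hF0
  set G := ∏ σ : K ≃ₐ[ℚ] K, diagMap σ F with hG
  have hG0 : G ≠ 0 := Finset.prod_ne_zero_iff.mpr fun σ _ ↦ by simpa using hF0
  have hGinv (τ : K ≃ₐ[ℚ] K) : diagMap τ G = G := by
    rw [hG, map_prod]
    exact Fintype.prod_equiv (Equiv.mulLeft τ) _ _ fun σ ↦ by simp [diagMap_mul]
  have hGe : expEval K G = 0 := by
    rw [hG, map_prod]
    exact Finset.prod_eq_zero (Finset.mem_univ 1) (by rw [diagMap_one, hF])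
  obtain ⟨a, ha⟩ : ∃ a, G.coeff a ≠ 0 := by
    by_contra! h
    exact hG0 (by ext a; simpa using h a)
  set T : AddMonoidAlgebra K K :=
    ∑ σ : K ≃ₐ[ℚ] K, diagMap σ (single (-a) (G.coeff a)⁻¹) with hT
  have hTinv (τ : K ≃ₐ[ℚ] K) : diagMap τ T = T := by
    rw [hT, map_sum]
    exact Fintype.sum_equiv (Equiv.mulLeft τ) _ _ fun σ ↦ by simp [diagMap_mul]
  refine sum_mul_exp_ne_zero_of_equivariant (G * T).coeff (fun σ b ↦ ?_) ?_ ?_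
  · rw [← coeff_diagMap, map_mul, hGinv, hTinv]
  · have h (σ : K ≃ₐ[ℚ] K) : (G * diagMap σ (single (-a) (G.coeff a)⁻¹)).coeff 0 = 1 := by
      have := coeff_diagMap σ (G * single (-a) (G.coeff a)⁻¹) 0
      rw [map_zero, map_mul, hGinv] at this
      rw [this]
      simp [coeff_mul_single_apply, ha]
    rw [hT, Finset.mul_sum, AddMonoidAlgebra.coeff_sum, Finsupp.finsetSum_apply]
    simp [h]
  · rw [← expEval_apply, map_mul, hGe, zero_mul]

/-- Finitely many algebraic numbers lie in a Galois number field inside `ℂ`. -/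
theorem exists_isGalois_intermediateField (S : Finset ℂ) (hS : ∀ x ∈ S, IsAlgebraic ℚ x) :
    ∃ K : IntermediateField ℚ ℂ, NumberField K ∧ IsGalois ℚ K ∧ ∀ x ∈ S, x ∈ K := by
  set q : ℚ[X] := ∏ x ∈ S, minpoly ℚ x with hq
  have hq0 : q ≠ 0 := Finset.prod_ne_zero_iff.mpr fun x hx ↦
    minpoly.ne_zero (hS x hx).isIntegral
  have hsplit : IsSplittingField ℚ (IntermediateField.adjoin ℚ (q.rootSet ℂ)) q := by
    convert! IntermediateField.adjoin_rootSet_isSplittingField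
      (IsAlgClosed.splits (q.map (algebraMap ℚ ℂ)))
  refine ⟨IntermediateField.adjoin ℚ (q.rootSet ℂ), ?_, ?_, fun x hx ↦ ?_⟩
  · have := IsSplittingField.finiteDimensional (IntermediateField.adjoin ℚ (q.rootSet ℂ)) q
    exact { }
  · have := Normal.of_isSplittingField (F := ℚ) (E := IntermediateField.adjoin ℚ (q.rootSet ℂ)) q
    exact { }
  · refine IntermediateField.subset_adjoin _ _ ((mem_rootSet_of_ne hq0).mpr ?_)
    rw [hq, map_prod]
    exact Finset.prod_eq_zero hx (minpoly.aeval ℚ x)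

end LindemannWeierstrass

/-- The Lindemann–Weierstrass theorem (1885): exponentials of distinct algebraic
numbers are linearly independent over the algebraic numbers. -/
theorem lindemann_weierstrass (n : ℕ) (α c : Fin n → ℂ)
    (hα : ∀ i, IsAlgebraic ℚ (α i)) (hdist : Function.Injective α)
    (hc : ∀ i, IsAlgebraic ℚ (c i)) (hne : ∃ i, c i ≠ 0) :
    ∑ i, c i * Complex.exp (α i) ≠ 0 := by
  classical
  obtain ⟨K, _, _, hK⟩ := LindemannWeierstrass.exists_isGalois_intermediateField
    (Finset.univ.image α ∪ Finset.univ.image c) (by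
      simp only [Finset.mem_union, Finset.mem_image, Finset.mem_univ, true_and]
      rintro _ (⟨i, rfl⟩ | ⟨i, rfl⟩)
      exacts [hα i, hc i])
  have hαK (i) : α i ∈ K := hK _ (by simp)
  have hcK (i) : c i ∈ K := hK _ (by simp)
  intro hsum
  set F : AddMonoidAlgebra K K :=
    ∑ i, AddMonoidAlgebra.single ⟨α i, hαK i⟩ ⟨c i, hcK i⟩ with hF
  have hF0 : F = 0 := by
    apply LindemannWeierstrass.expEval_injective K
    rw [map_zero, hF, map_sum, ← hsum]
    refine Finset.sum_congr rfl fun i _ ↦ ?_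
    rw [LindemannWeierstrass.expEval_apply, AddMonoidAlgebra.coeff_single,
      Finsupp.sum_single_index (by simp)]
    rfl
  obtain ⟨i, hi⟩ := hne
  have h := congrArg (fun G ↦ AddMonoidAlgebra.coeff G ⟨α i, hαK i⟩) hF0
  simp only [hF, AddMonoidAlgebra.coeff_sum, Finsupp.finsetSum_apply,
    AddMonoidAlgebra.coeff_single, Finsupp.single_apply, Subtype.mk.injEq, hdist.eq_iff] at h
  simp at h
  exact hi (congrArg Subtype.val h)
end

section
/- Let n ≥ 2, let U be an open subset of ℂⁿ, let f : ℂⁿ → ℂ be analytic on U, and let z₀ ∈ U with f(z₀) = 0. Then z₀ is not an isolated zero of f: every neighborhood of z₀ contains a point z ≠ z₀ with f(z) = 0. -/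
open Filter Topology Metric in
/-- A zero of an analytic function of two complex variables is never isolated. -/
theorem AnalyticAt.frequently_eq_zero_prod {g : ℂ × ℂ → ℂ} (hg : AnalyticAt ℂ g 0)
    (hg0 : g 0 = 0) : ∃ᶠ z in 𝓝[≠] 0, g z = 0 := by
  intro hne
  rw [eventually_nhdsWithin_iff] at hne
  obtain ⟨ε, hε, hball⟩ := Metric.eventually_nhds_iff.1 (hg.eventually_analyticAt.and hne)
  obtain ⟨r, hr, hrε⟩ := exists_between hε
  have hslice : ∀ s : ℂ, ‖s‖ < ε → ∀ t ∈ closedBall (0 : ℂ) r,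
      AnalyticAt ℂ g (s, t) ∧ ((s, t) ≠ 0 → g (s, t) ≠ 0) := fun s hs t ht ↦
    hball (by
      rw [dist_zero_right, Prod.norm_def]
      exact max_lt hs ((mem_closedBall_zero_iff.1 ht).trans_lt hrε))
  have hcont : ContinuousOn (fun t : ℂ ↦ ‖g (0, t)‖) (sphere 0 r) := fun t ht ↦ by
    have h := (hslice 0 (by simpa using hε) t (sphere_subset_closedBall ht)).1.continuousAt
    exact (h.comp (f := fun t : ℂ ↦ ((0 : ℂ), t)) (by fun_prop)).norm.continuousWithinAt
  obtain ⟨t₀, ht₀, hmin⟩ := (isCompact_sphere (0 : ℂ) r).exists_isMinOn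
    (NormedSpace.sphere_nonempty.2 hr.le) hcont
  have hm : 0 < ‖g (0, t₀)‖ := by
    refine norm_pos_iff.2 ((hslice 0 (by simpa using hε) t₀ (sphere_subset_closedBall ht₀)).2 ?_)
    intro h
    have : t₀ = 0 := congrArg Prod.snd h
    simp [this] at ht₀
    exact hr.ne ht₀
  set m := ‖g (0, t₀)‖
  have hsphere : ∀ᶠ s in 𝓝 (0 : ℂ), ∀ t ∈ sphere (0 : ℂ) r, m / 2 < ‖g (s, t)‖ := by
    refine (isCompact_sphere (0 : ℂ) r).eventually_forall_of_forall_eventually fun t ht ↦ ?_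
    have h := (hslice 0 (by simpa using hε) t (sphere_subset_closedBall ht)).1.continuousAt
    exact h.norm.eventually (lt_mem_nhds ((half_lt_self hm).trans_le (hmin ht)))
  have hcenter : ∀ᶠ s in 𝓝 (0 : ℂ), ‖g (s, 0)‖ < m / 2 := by
    have h : ContinuousAt (fun s : ℂ ↦ ‖g (s, 0)‖) 0 :=
      (ContinuousAt.comp (f := fun s : ℂ ↦ (s, (0 : ℂ))) hg.continuousAt (by fun_prop)).norm
    refine h.eventually (gt_mem_nhds ?_)
    change ‖g 0‖ < m / 2
    rw [hg0, norm_zero]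
    exact half_pos hm
  have hsmall : ∀ᶠ s in 𝓝 (0 : ℂ), ‖s‖ < ε := by
    filter_upwards [ball_mem_nhds (0 : ℂ) hε] with s hs using mem_ball_zero_iff.1 hs
  obtain ⟨s, ⟨hs₁, hs₂, hs₃⟩, hs₀ : s ≠ 0⟩ :=
    ((((hsphere.and (hcenter.and hsmall)).filter_mono nhdsWithin_le_nhds).and
      (self_mem_nhdsWithin (a := (0 : ℂ)) (s := {0}ᶜ))).exists)
  have hnz : ∀ t ∈ closedBall (0 : ℂ) r, g (s, t) ≠ 0 := fun t ht ↦
    (hslice s hs₃ t ht).2 fun h ↦ hs₀ (congrArg Prod.fst h)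
  have hdiff : DiffContOnCl ℂ (fun t ↦ (g (s, t))⁻¹) (ball 0 r) := by
    refine DifferentiableOn.diffContOnCl fun t ht ↦ ?_
    rw [closure_ball _ hr.ne'] at ht
    have h := (hslice s hs₃ t ht).1.differentiableAt
    exact ((h.comp t (f := fun t : ℂ ↦ (s, t)) (by fun_prop)).inv
      (hnz t ht)).differentiableWithinAt
  have hmax := Complex.norm_le_of_forall_mem_frontier_norm_le isBounded_ball hdiff
    (C := (m / 2)⁻¹) (fun t ht ↦ by
      rw [frontier_ball _ hr.ne'] at ht
      rw [norm_inv]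
      exact inv_anti₀ (half_pos hm) (hs₁ t ht).le) (subset_closure (mem_ball_self hr))
  rw [norm_inv, inv_le_inv₀ (norm_pos_iff.2 (hnz 0 (mem_closedBall_self hr.le)))
    (half_pos hm)] at hmax
  exact hmax.not_gt hs₂


/-- Consequence of the Weierstrass preparation theorem: for `n ≥ 2`, a zero of a
function analytic on an open subset of `ℂⁿ` is never isolated. -/
theorem analytic_zero_not_isolated (n : ℕ) (hn : 2 ≤ n)
    (U : Set (Fin n → ℂ)) (hU : IsOpen U)
    (f : (Fin n → ℂ) → ℂ) (hf : AnalyticOnNhd ℂ f U)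
    (z₀ : Fin n → ℂ) (hz₀ : z₀ ∈ U) (hf0 : f z₀ = 0) :
    ∀ V ∈ nhds z₀, ∃ z ∈ V, z ≠ z₀ ∧ f z = 0 := by
  intro V hV
  let i : Fin n := ⟨0, by omega⟩
  let j : Fin n := ⟨1, by omega⟩
  have hij : i ≠ j := by simp [i, j]
  let L : ℂ × ℂ →L[ℂ] (Fin n → ℂ) :=
    (ContinuousLinearMap.single ℂ (fun _ ↦ ℂ) i).coprod
      (ContinuousLinearMap.single ℂ (fun _ ↦ ℂ) j)
  have hL : ∀ q, L q = 0 → q = 0 := fun q hq ↦ by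
    have h₁ := congrFun hq i
    have h₂ := congrFun hq j
    ext <;> simp_all [L]
  have hφ : AnalyticAt ℂ (fun q ↦ z₀ + L q) 0 := analyticAt_const.add (L.analyticAt 0)
  have hg : AnalyticAt ℂ (fun q ↦ f (z₀ + L q)) 0 :=
    AnalyticAt.comp (by simpa using hf z₀ hz₀) hφ
  have hV' : ∀ᶠ q in nhdsWithin (0 : ℂ × ℂ) {0}ᶜ, z₀ + L q ∈ V :=
    (hφ.continuousAt.eventually_mem (by simpa using hV)).filter_mono nhdsWithin_le_nhds
  obtain ⟨q, hq, hqV, hq₀⟩ := ((hg.frequently_eq_zero_prod (by simpa using hf0)).and_eventually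
    (hV'.and self_mem_nhdsWithin)).exists
  exact ⟨z₀ + L q, hqV, fun h ↦ hq₀ (hL q (by simpa using h)), hq⟩
end
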